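/- Fix β > 0 and a ≥ 0. For each integer n > 4β² set p_n = 1/2 + β/√n and q_n = 1/2 − β/√n. Then lim_{n→∞} [ ( (p_n − q_n)/(p_n q_n) ) · Σ_{k ≥ a√n·log n, k even} (q_n/p_n)^k ] / n^{−4βa} = 1, where the sum is over even nonnegative integers k with k ≥ a√n·log n. -/

import Mathlib

open Filter
open scoped Classical

lemma aux_sum (A r : ℝ) (hr0 : 0 < r) (hr1 : r < 1) :
    (∑' k : ℕ, if A ≤ (k : ℝ) ∧ Even k then r ^ k else 0)
      = r ^ (2 * ⌈A / 2⌉₊) / (1 - r ^ 2) := by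
  set m := ⌈A / 2⌉₊ with hm
  have hinj : Function.Injective (fun j : ℕ => 2 * (m + j)) := by
    intro i j h
    simp only at h
    omega
  have hsupp : Function.support (fun k : ℕ => if A ≤ (k : ℝ) ∧ Even k then r ^ k else 0)
      ⊆ Set.range (fun j : ℕ => 2 * (m + j)) := by
    intro k hk
    simp only [Function.mem_support, ne_eq, ite_eq_right_iff, not_forall] at hk
    obtain ⟨⟨h1, h2⟩, -⟩ := hk
    obtain ⟨l, rfl⟩ := h2
    have : m ≤ l := by
      rw [hm]
      apply Nat.ceil_le.mpr
      push_cast at h1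
      linarith
    refine ⟨l - m, ?_⟩
    simp only
    omega
  rw [← hinj.tsum_eq hsupp]
  have hterm : ∀ j : ℕ, (if A ≤ ((2 * (m + j) : ℕ) : ℝ) ∧ Even (2 * (m + j)) then
      r ^ (2 * (m + j)) else 0) = r ^ (2 * m) * (r ^ 2) ^ j := by
    intro j
    rw [if_pos]
    · rw [mul_add, pow_add, pow_mul r 2 j]
    · refine ⟨?_, even_two_mul _⟩
      have h := Nat.le_ceil (A / 2)
      rw [← hm] at h
      push_cast
      have : (0 : ℝ) ≤ j := Nat.cast_nonneg j
      linarith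
  simp_rw [hterm]
  rw [tsum_mul_left, tsum_geometric_of_lt_one (by positivity) (by nlinarith)]
  rfl

lemma aux_closed (A x : ℝ) (hx0 : 0 < x) (hx1 : x < 1 / 2) :
    ((((1 / 2 + x) - (1 / 2 - x)) / ((1 / 2 + x) * (1 / 2 - x))) *
            ∑' k : ℕ,
              if A ≤ (k : ℝ) ∧ Even k then
                ((1 / 2 - x) / (1 / 2 + x)) ^ k
              else 0) =
    Real.exp ((2 * (⌈A / 2⌉₊ : ℝ) - 1) * Real.log ((1 / 2 - x) / (1 / 2 + x))) := by
  have hp : 0 < 1 / 2 + x := by linarith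
  have hq : 0 < 1 / 2 - x := by linarith
  have hr0 : 0 < (1 / 2 - x) / (1 / 2 + x) := by positivity
  have hr1 : (1 / 2 - x) / (1 / 2 + x) < 1 := by
    rw [div_lt_one hp]; linarith
  rw [aux_sum _ _ hr0 hr1, sub_mul, Real.exp_sub, one_mul, Real.exp_log hr0]
  have : Real.exp (2 * (⌈A / 2⌉₊ : ℝ) * Real.log ((1 / 2 - x) / (1 / 2 + x)))
      = ((1 / 2 - x) / (1 / 2 + x)) ^ (2 * ⌈A / 2⌉₊) := by
    have h : (2 * (⌈A / 2⌉₊ : ℝ)) = ((2 * ⌈A / 2⌉₊ : ℕ) : ℝ) := by push_cast; rfl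
    rw [h, Real.exp_nat_mul, Real.exp_log hr0]
  rw [this]
  generalize ((1 / 2 - x) / (1 / 2 + x)) ^ (2 * ⌈A / 2⌉₊) = R
  have h1 : 1 - ((1 / 2 - x) / (1 / 2 + x)) ^ 2 = 2 * x / (1 / 2 + x) ^ 2 := by
    rw [div_pow, eq_div_iff (by positivity), sub_mul, div_mul_cancel₀ _ (by positivity)]
    ring
  rw [h1]
  have e : (1 / 2 + x) - (1 / 2 - x) = 2 * x := by ring
  rw [e]
  generalize 1 / 2 + x = p at *
  generalize 1 / 2 - x = q at *
  field_simp

lemma aux_log (x : ℝ) (hx0 : 0 < x) (hx1 : x ≤ 1 / 4) :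
    |Real.log ((1 / 2 - x) / (1 / 2 + x)) + 4 * x| ≤ 8 * x ^ 2 := by
  have h1 : (1 / 2 - x) / (1 / 2 + x) = (1 - 2 * x) / (1 + 2 * x) := by
    rw [div_eq_div_iff (by linarith) (by linarith)]; ring
  have hm : 0 < 1 - 2 * x := by linarith
  have hp : 0 < 1 + 2 * x := by linarith
  rw [h1, Real.log_div hm.ne' hp.ne']
  have a1 := Real.log_le_sub_one_of_pos hm
  have a2 := Real.log_le_sub_one_of_pos hp
  have a3 := Real.one_sub_inv_le_log_of_pos hm
  have a4 := Real.one_sub_inv_le_log_of_pos hp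
  have b1 : (1 - 2 * x)⁻¹ ≤ 1 + 2 * x + 8 * x ^ 2 := by
    rw [inv_le_iff_one_le_mul₀ hm]
    nlinarith [mul_nonneg (sq_nonneg x) (by linarith : 0 ≤ 1 - 4 * x)]
  have b2 : (1 + 2 * x)⁻¹ ≤ 1 - 2 * x + 4 * x ^ 2 := by
    rw [inv_le_iff_one_le_mul₀ hp]
    nlinarith [pow_pos hx0 3]
  rw [abs_le]
  constructor <;> nlinarith [sq_nonneg x]

/-- With `p_n = 1/2 + β/√n` and `q_n = 1/2 - β/√n`,
`[((p_n - q_n)/(p_n q_n)) · Σ_{k ≥ a√n log n, k even} (q_n/p_n)^k] / n^{-4βa} → 1`,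
the limit being taken over integers `n > 4β²`. -/
theorem geometric_tail_sum_log_limit (β a : ℝ) (hβ : 0 < β) (ha : 0 ≤ a) :
    Tendsto
      (fun n : ℕ =>
        ((((1 / 2 + β / Real.sqrt n) - (1 / 2 - β / Real.sqrt n)) /
              ((1 / 2 + β / Real.sqrt n) * (1 / 2 - β / Real.sqrt n))) *
            ∑' k : ℕ,
              if a * Real.sqrt n * Real.log n ≤ (k : ℝ) ∧ Even k then
                ((1 / 2 - β / Real.sqrt n) / (1 / 2 + β / Real.sqrt n)) ^ k
              else 0) /
          (n : ℝ) ^ (-(4 * β * a)))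
      (atTop ⊓ 𝓟 {n : ℕ | 4 * β ^ 2 < (n : ℝ)})
      (nhds 1) := by
  have hsq : Tendsto (fun n : ℕ => Real.sqrt (n : ℝ)) atTop atTop :=
    Real.tendsto_sqrt_atTop.comp tendsto_natCast_atTop_atTop
  have hx : Tendsto (fun n : ℕ => β / Real.sqrt (n : ℝ)) atTop (nhds 0) :=
    hsq.const_div_atTop β
  have hlog : Tendsto (fun n : ℕ => Real.log (n : ℝ) / Real.sqrt (n : ℝ)) atTop (nhds 0) := by
    have h := (isLittleO_log_rpow_atTop (r := 1 / 2) (by norm_num)).tendsto_div_nhds_zero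
    have h2 := h.comp (tendsto_natCast_atTop_atTop (R := ℝ))
    simpa [Function.comp_def, Real.sqrt_eq_rpow] using h2
  refine Tendsto.mono_left ?_ inf_le_left
  have key : Tendsto (fun n : ℕ =>
      (2 * (⌈(a * Real.sqrt n * Real.log n) / 2⌉₊ : ℝ) - 1) *
        Real.log ((1 / 2 - β / Real.sqrt n) / (1 / 2 + β / Real.sqrt n))
        + 4 * β * a * Real.log n) atTop (nhds 0) := by
    have hb : Tendsto (fun n : ℕ => 8 * a * β ^ 2 * (Real.log (n : ℝ) / Real.sqrt (n : ℝ))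
        + (8 * (β / Real.sqrt (n : ℝ)) ^ 2 + 4 * (β / Real.sqrt (n : ℝ)))) atTop (nhds 0) := by
      have := (hlog.const_mul (8 * a * β ^ 2)).add
        (((hx.pow 2).const_mul 8).add (hx.const_mul 4))
      simpa using this
    refine squeeze_zero_norm' ?_ hb
    filter_upwards [eventually_ge_atTop 1,
      hx.eventually_lt_const (by norm_num : (0 : ℝ) < 1 / 4)] with n hn hxn
    have hn1 : (1 : ℝ) ≤ n := by exact_mod_cast hn
    have hs : 0 < Real.sqrt (n : ℝ) := Real.sqrt_pos.mpr (by linarith)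
    have hL : 0 ≤ Real.log (n : ℝ) := Real.log_nonneg hn1
    generalize Real.log (n : ℝ) = L at *
    generalize Real.sqrt (n : ℝ) = s at *
    have hx0 : 0 < β / s := by positivity
    have hl := aux_log _ hx0 hxn.le
    have hA : 0 ≤ a * s * L := by positivity
    have c1 := Nat.le_ceil (a * s * L / 2)
    have c2 := Nat.ceil_lt_add_one (a := a * s * L / 2) (by positivity)
    generalize (⌈a * s * L / 2⌉₊ : ℝ) = K at *
    generalize Real.log ((1 / 2 - β / s) / (1 / 2 + β / s)) = l at *
    have he : |2 * K - 1 - a * s * L| ≤ 1 := by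
      rw [abs_le]; constructor <;> linarith
    have hl2 : |l| ≤ 8 * (β / s) ^ 2 + 4 * (β / s) := by
      rw [abs_le] at hl ⊢
      constructor <;> nlinarith [hl.1, hl.2]
    have e : (2 * K - 1) * l + 4 * β * a * L
        = (a * s * L) * (l + 4 * (β / s)) + (2 * K - 1 - a * s * L) * l := by
      field_simp
      ring
    rw [e, Real.norm_eq_abs]
    refine (abs_add_le _ _).trans ?_
    rw [abs_mul (a * s * L), abs_mul (2 * K - 1 - a * s * L), abs_of_nonneg hA]
    have d1 : (a * s * L) * |l + 4 * (β / s)| ≤ 8 * a * β ^ 2 * (L / s) := by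
      refine (mul_le_mul_of_nonneg_left hl hA).trans (le_of_eq ?_)
      field_simp
    have d2 : |2 * K - 1 - a * s * L| * |l| ≤ 8 * (β / s) ^ 2 + 4 * (β / s) := by
      refine (mul_le_mul_of_nonneg_right he (abs_nonneg l)).trans ?_
      rw [one_mul]; exact hl2
    exact add_le_add d1 d2
  have hexp := (Real.continuous_exp.tendsto 0).comp key
  rw [Real.exp_zero] at hexp
  refine hexp.congr' ?_
  filter_upwards [eventually_ge_atTop 1,
    hx.eventually_lt_const (by norm_num : (0 : ℝ) < 1 / 2)] with n hn hxn
  have hn1 : (1 : ℝ) ≤ n := by exact_mod_cast hn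
  have hs : 0 < Real.sqrt (n : ℝ) := Real.sqrt_pos.mpr (by linarith)
  rw [aux_closed _ _ (by positivity) hxn, Real.rpow_def_of_pos (by linarith), ← Real.exp_sub]
  simp only [Function.comp_apply]
  congr 1
  ring
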